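/- arXiv:2509.12911 — 4 statements merged into one kernel-verified Lean document; each statement's English description precedes it below -/
import Mathlib

section
/- Let H be a complex Hilbert space and let M_A and M_B be von Neumann algebras on H that commute (a * b = b * a for all a ∈ M_A, b ∈ M_B). Then the pair (M_A, M_B) has the Uhlmann property if and only if Haag duality holds, i.e. M_B equals the commutant of M_A. -/
open scoped InnerProductSpace

/-- The pair `(M_A, M_B)` of von Neumann algebras has the *Uhlmann property* if any two
unit vectors inducing the same state on `M_A` can be mapped onto each other, up to
arbitrarily small error, by unitaries of `M_B`. -/
def UhlmannProperty {H : Type*} [NormedAddCommGroup H] [InnerProductSpace ℂ H]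
    [CompleteSpace H] (M_A M_B : VonNeumannAlgebra H) : Prop :=
  ∀ Ψ Φ : H, ‖Ψ‖ = 1 → ‖Φ‖ = 1 →
    (∀ a ∈ M_A, ⟪Ψ, a Ψ⟫_ℂ = ⟪Φ, a Φ⟫_ℂ) →
    ∀ ε : ℝ, 0 < ε →
      ∃ u ∈ M_B, star u * u = 1 ∧ u * star u = 1 ∧ ‖⟪Ψ, u Φ⟫_ℂ‖ ≥ 1 - ε

section Helpers


lemma cstar_unitary_add {A : Type*} [CStarAlgebra A] (u : A) (hu : u ∈ unitary A) (a : A)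
    (ha : ‖a‖ < 1) : ∃ v ∈ unitary A, ∃ w ∈ unitary A, u + a = v + w := by
  let _ := CStarAlgebra.spectralOrder A
  let _ := CStarAlgebra.spectralOrderedRing A
  obtain (_ | _) := subsingleton_or_nontrivial A
  · exact ⟨1, one_mem _, 1, one_mem _, Subsingleton.elim _ _⟩
  have hu1 : ‖u‖ = 1 := CStarRing.norm_of_mem_unitary hu
  have hunit : IsUnit (u + a) := by
    have h1 : u + a = u * (1 - (-(star u * a))) := by
      rw [sub_neg_eq_add, mul_add, mul_one, ← mul_assoc, (Unitary.mem_iff.1 hu).2, one_mul]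
    rw [h1]
    refine IsUnit.mul ?_ (isUnit_one_sub_of_norm_lt_one ?_)
    · exact ⟨⟨u, star u, (Unitary.mem_iff.1 hu).2, (Unitary.mem_iff.1 hu).1⟩, rfl⟩
    · rw [norm_neg]
      calc _ ≤ ‖star u‖ * ‖a‖ := norm_mul_le _ _
        _ < 1 := by rw [norm_star, hu1]; linarith
  set y : A := (2⁻¹ : ℂ) • (u + a) with hy
  have hyu : IsUnit y := by
    have : y = algebraMap ℂ A 2⁻¹ * (u + a) := by rw [hy, Algebra.smul_def]
    rw [this]
    exact ((IsUnit.mk0 (2⁻¹ : ℂ) (by norm_num)).map (algebraMap ℂ A)).mul hunit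
  have hyn : ‖y‖ ≤ 1 := by
    have := norm_add_le u a
    rw [hy, norm_smul]; norm_num; linarith
  have hb : 0 ≤ star y * y := star_mul_self_nonneg y
  set h : A := CFC.sqrt (star y * y) with hh
  have hhh : h * h = star y * y := CFC.sqrt_mul_sqrt_self _ hb
  have hsa : star h = h := (CFC.sqrt_nonneg (star y * y)).isSelfAdjoint
  have hunith : IsUnit h := by
    have : IsUnit (h * h) := by rw [hhh]; exact hyu.star.mul hyu
    exact (Commute.isUnit_mul_iff (Commute.refl h)).1 this |>.1
  have hn : ‖h‖ ≤ 1 := by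
    have : ‖h‖ * ‖h‖ = ‖y‖ * ‖y‖ := by
      rw [← CStarRing.norm_star_mul_self, hsa, hhh, CStarRing.norm_star_mul_self]
    nlinarith [norm_nonneg h, norm_nonneg y]
  obtain ⟨k, hk⟩ := hunith
  have hz := IsSelfAdjoint.self_add_I_smul_cfcSqrt_sub_sq_mem_unitary h hsa hn
  set s := CFC.sqrt (1 - h ^ 2) with hs
  have hss : star s = s := (CFC.sqrt_nonneg (1 - h ^ 2)).isSelfAdjoint
  have hkinv : star (↑k⁻¹ : A) = ↑k⁻¹ := by
    rw [← hk] at hsa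
    have : star k = k := Units.ext hsa
    rw [← Units.coe_star, star_inv, this]
  have hv : y * ↑k⁻¹ ∈ unitary A := by
    have h1 : star (y * ↑k⁻¹) * (y * (↑k⁻¹ : A)) = 1 := by
      rw [star_mul, hkinv, mul_assoc, ← mul_assoc (star y), ← hhh, ← hk]
      simp
    have h2 : IsUnit (y * (↑k⁻¹ : A)) := hyu.mul (Units.isUnit _)
    refine Unitary.mem_iff.2 ⟨h1, ?_⟩
    obtain ⟨g, hg⟩ := h2
    rw [← hg] at h1 ⊢
    rw [← Units.mul_eq_one_iff_eq_inv.1 h1 |>.symm] 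
    simp
  refine ⟨_, mul_mem hv hz, _, mul_mem hv (Unitary.star_mem hz), ?_⟩
  have : star (h + Complex.I • s) = h - Complex.I • s := by
    simp [hsa, hss, sub_eq_add_neg]
  rw [this, ← mul_add]
  have : h + Complex.I • s + (h - Complex.I • s) = (2 : ℂ) • h := by module
  rw [this, mul_smul_comm, mul_assoc, ← hk, Units.inv_mul, mul_one, hy, smul_smul]
  norm_num

lemma cstar_unitary_sup {A : Type*} [CStarAlgebra A] (f : A →L[ℂ] ℂ) (a : A)
    (ha : ‖a‖ < 1) (ε : ℝ) (hε : 0 < ε) : ∃ u ∈ unitary A, (f a).re - ε ≤ (f u).re := by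
  by_contra! hcon
  let S : Set ℝ := (fun u => (f u).re) '' (unitary A : Set A)
  have hne : S.Nonempty := ⟨_, 1, one_mem _, rfl⟩
  have hbd : BddAbove S := by
    refine ⟨(f a).re - ε, ?_⟩
    rintro _ ⟨u, hu, rfl⟩
    exact (hcon u hu).le
  have h1 : sSup S ≤ (f a).re - ε := by
    refine csSup_le hne ?_
    rintro _ ⟨u, hu, rfl⟩
    exact (hcon u hu).le
  have h2 : sSup S ≤ 2 * sSup S - (f a).re := by
    refine csSup_le hne ?_
    rintro _ ⟨u, hu, rfl⟩
    obtain ⟨v, hv, w, hw, h⟩ := cstar_unitary_add u hu a ha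
    have e := congrArg (fun x => (f x).re) h
    simp only [map_add, Complex.add_re] at e
    have := le_csSup hbd ⟨v, hv, rfl⟩
    have := le_csSup hbd ⟨w, hw, rfl⟩
    simp only at *
    linarith
  linarith

variable {H : Type*} [NormedAddCommGroup H] [InnerProductSpace ℂ H] [CompleteSpace H]

lemma vna_isClosed (M : VonNeumannAlgebra H) : IsClosed (M : Set (H →L[ℂ] H)) := by
  rw [← M.centralizer_centralizer]
  exact Set.isClosed_centralizer _

lemma vna_unitary_sup (M : VonNeumannAlgebra H) (Ψ Φ : H) (a : H →L[ℂ] H) (haM : a ∈ M)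
    (ha : ‖a‖ < 1) (ε : ℝ) (hε : 0 < ε) :
    ∃ u ∈ M, star u * u = 1 ∧ u * star u = 1 ∧ (⟪Ψ, a Φ⟫_ℂ).re - ε ≤ (⟪Ψ, u Φ⟫_ℂ).re := by
  let S := M.toStarSubalgebra
  have hS : IsClosed (S : Set (H →L[ℂ] H)) := vna_isClosed M
  let _ : CStarAlgebra S := StarSubalgebra.cstarAlgebra S (h_closed := hS)
  let f : S →L[ℂ] ℂ := (innerSL ℂ Ψ).comp ((ContinuousLinearMap.apply ℂ H Φ).comp
    S.toSubalgebra.toSubmodule.subtypeL)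
  obtain ⟨u, hu, h⟩ := cstar_unitary_sup f ⟨a, haM⟩ ha ε hε
  refine ⟨u.1, u.2, ?_, ?_, h⟩
  · exact congrArg Subtype.val (Unitary.mem_iff.1 hu).1
  · exact congrArg Subtype.val (Unitary.mem_iff.1 hu).2

lemma vna_le_of_unitary (M : VonNeumannAlgebra H) (p : (H →L[ℂ] H) → Prop)
    (h0 : p 0) (hadd : ∀ x y, p x → p y → p (x + y)) (hsmul : ∀ (c : ℂ) x, p x → p (c • x))
    (hu : ∀ u ∈ M, star u * u = 1 → u * star u = 1 → p u) (x : H →L[ℂ] H) (hx : x ∈ M) : p x := by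
  let S := M.toStarSubalgebra
  have hS : IsClosed (S : Set (H →L[ℂ] H)) := vna_isClosed M
  let _ : CStarAlgebra S := StarSubalgebra.cstarAlgebra S (h_closed := hS)
  have h : (⟨x, hx⟩ : S) ∈ Submodule.span ℂ (unitary S : Set S) := by
    rw [CStarAlgebra.span_unitary]; trivial
  change p ((⟨x, hx⟩ : S) : H →L[ℂ] H)
  generalize (⟨x, hx⟩ : S) = t at h
  induction h using Submodule.span_induction with
  | mem u h => exact hu u.1 u.2 (congrArg Subtype.val (Unitary.mem_iff.1 h).1) 
                (congrArg Subtype.val (Unitary.mem_iff.1 h).2)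
  | zero => exact h0
  | add y z _ _ hy hz => exact hadd _ _ hy hz
  | smul c y _ hy => exact hsmul c _ hy

lemma vna_smul_mem (M : VonNeumannAlgebra H) (c : ℂ) {x : H →L[ℂ] H} (hx : x ∈ M) : c • x ∈ M :=
  M.toStarSubalgebra.smul_mem hx c

lemma vna_starProjection_mem (M : VonNeumannAlgebra H) (K : Submodule ℂ H) [K.HasOrthogonalProjection]
    (h : ∀ y ∈ M.commutant, ∀ k ∈ K, y k ∈ K) : K.starProjection ∈ M := by
  rw [VonNeumannAlgebra.IsStarProjection.mem_iff isStarProjection_starProjection]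
  intro y hy
  rw [Module.End.mem_invtSubmodule]
  intro k hk
  simp only [Submodule.range_starProjection, Submodule.mem_comap] at hk ⊢
  exact h y hy k hk

lemma vna_dyadic_step (N : VonNeumannAlgebra H) (x : H →L[ℂ] H) (hxN : x ∈ N) (c : ℝ)
    (hx0 : 0 ≤ x) (hxc : x ≤ algebraMap ℝ (H →L[ℂ] H) c) :
    ∃ p ∈ N, IsStarProjection p ∧ 0 ≤ x - ((c / 2 : ℝ) : ℂ) • p ∧
      x - ((c / 2 : ℝ) : ℂ) • p ≤ algebraMap ℝ (H →L[ℂ] H) (c / 2) := by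
  set d : ℂ := ((c / 2 : ℝ) : ℂ) with hd
  have hd1 : algebraMap ℝ (H →L[ℂ] H) (c / 2) = d • 1 := by
    rw [Algebra.algebraMap_eq_smul_one, hd, Complex.coe_smul]
  have hc1 : algebraMap ℝ (H →L[ℂ] H) c = d • 1 + d • 1 := by
    rw [← hd1, ← map_add, add_halves]
  rw [hc1] at hxc
  rw [hd1]
  have hdsa : IsSelfAdjoint (d • (1 : H →L[ℂ] H)) := by
    rw [← hd1]; exact IsSelfAdjoint.algebraMap _ (IsSelfAdjoint.all _)
  have hysa : IsSelfAdjoint (x - d • 1) := (IsSelfAdjoint.of_nonneg hx0).sub hdsa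
  have hsub := CFC.posPart_sub_negPart (x - d • 1) hysa
  have hmul := CFC.negPart_mul_posPart (x - d • 1)
  have hP := CFC.posPart_nonneg (x - d • 1)
  have hQ := CFC.negPart_nonneg (x - d • 1)
  have hcomm : ∀ m ∈ N.commutant, Commute ((x - d • 1)⁻) m := by
    intro m hm
    have h1 : Commute (x - d • 1) m := by
      have := VonNeumannAlgebra.mem_commutant_iff.1 hm x hxN
      have h2 : Commute x m := this
      exact h2.sub_left ((Commute.one_left m).smul_left d)
    rw [CFC.negPart_def]
    exact h1.cfcₙ_real _
  set P := (x - d • 1)⁺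
  set Q := (x - d • 1)⁻
  let K : Submodule ℂ H := Q.ker
  have hKc : IsClosed (K : Set H) := Q.isClosed_ker
  have : CompleteSpace K := hKc.completeSpace_coe
  have hpN : K.starProjection ∈ N := by
    refine vna_starProjection_mem N K ?_
    intro y hy k hk
    have h1 : Q k = 0 := hk
    have h2 := DFunLike.congr_fun (hcomm y hy) k
    change Q (y k) = y (Q k) at h2
    change Q (y k) = 0
    rw [h2, h1, map_zero]
  have hpp : IsStarProjection K.starProjection := isStarProjection_starProjection
  have hQp : Q * K.starProjection = 0 := by
    ext k
    exact (K.starProjection_apply_mem k : _)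
  have hpP : K.starProjection * P = P := by
    ext k
    refine Submodule.starProjection_eq_self_iff.2 ?_
    exact DFunLike.congr_fun hmul k
  set p := K.starProjection
  have hps : star p = p := hpp.isSelfAdjoint
  have hpi : p * p = p := hpp.isIdempotentElem
  have hpQ : p * Q = 0 := by
    have := congrArg star hQp
    rwa [star_mul, hps, star_zero, (IsSelfAdjoint.of_nonneg hQ).star_eq] at this
  have hPp : P * p = P := by
    have := congrArg star hpP
    rwa [star_mul, hps, (IsSelfAdjoint.of_nonneg hP).star_eq] at this
  have hx : x = d • 1 + P - Q := by rw [add_sub_assoc, hsub]; abel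
  refine ⟨p, hpN, hpp, ?_, ?_⟩
  · have e : x - d • p = P + star (1 - p) * x * (1 - p) := by
      rw [star_sub, star_one, hps, hx]
      simp only [sub_mul, mul_sub, add_mul, mul_add, one_mul, mul_one, smul_mul_assoc,
        mul_smul_comm, hpP, hPp, hpQ, hQp, hpi]
      simp only [smul_sub, zero_mul]
      abel
    rw [e]
    exact add_nonneg hP (star_left_conjugate_nonneg hx0 _)
  · rw [← sub_nonneg]
    have e : d • 1 - (x - d • p) = star p * (d • 1 + d • 1 - x) * p + Q := by
      rw [hps, hx]
      simp only [sub_mul, mul_sub, add_mul, mul_add, one_mul, mul_one, smul_mul_assoc,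
        mul_smul_comm, hpP, hPp, hpQ, hQp, hpi]
      simp only [zero_mul]
      abel
    rw [e]
    exact add_nonneg (star_left_conjugate_nonneg (sub_nonneg.2 hxc) _) hQ

lemma vna_dyadic (N M : VonNeumannAlgebra H) (hp : ∀ p ∈ N, IsStarProjection p → p ∈ M) (n : ℕ) :
    ∀ (x : H →L[ℂ] H), x ∈ N → ∀ c : ℝ, 0 ≤ c → 
    0 ≤ x → x ≤ algebraMap ℝ (H →L[ℂ] H) c → ∃ s ∈ M, ‖x - s‖ ≤ c / 2 ^ n := by
  induction n with
  | zero =>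
    intro x _ c hc h0 h1
    refine ⟨0, zero_mem M, ?_⟩
    simpa using (CStarAlgebra.norm_le_iff_le_algebraMap x hc h0).2 h1
  | succ n ih =>
    intro x hx c hc h0 h1
    obtain ⟨p, hpN, hpp, h2, h3⟩ := vna_dyadic_step N x hx c h0 h1
    obtain ⟨s, hs, h⟩ := ih _ (sub_mem hx (vna_smul_mem N _ hpN)) (c / 2) (by positivity) h2 h3
    refine ⟨((c / 2 : ℝ) : ℂ) • p + s, add_mem (vna_smul_mem M _ (hp p hpN hpp)) hs, ?_⟩
    rw [← sub_sub]
    refine h.trans (le_of_eq ?_)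
    rw [pow_succ]; field_simp

lemma vna_le_of_proj (N M : VonNeumannAlgebra H) (hp : ∀ p ∈ N, IsStarProjection p → p ∈ M)
    (x : H →L[ℂ] H) (hx : x ∈ N) : x ∈ M := by
  have hpos : ∀ x ∈ N, 0 ≤ x → x ∈ M := by
    intro x hx h0
    have : x ∈ closure (M : Set (H →L[ℂ] H)) := by
      rw [Metric.mem_closure_iff]
      intro ε hε
      obtain ⟨n, hn⟩ := exists_nat_gt (‖x‖ / ε)
      obtain ⟨s, hs, h⟩ := vna_dyadic N M hp n x hx ‖x‖ (norm_nonneg x) h0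
        (IsSelfAdjoint.of_nonneg h0).le_algebraMap_norm_self
      refine ⟨s, hs, ?_⟩
      rw [dist_eq_norm]
      refine h.trans_lt ?_
      have h2 : (n : ℝ) < 2 ^ n := by exact_mod_cast Nat.lt_two_pow_self
      rw [div_lt_iff₀ (by positivity)]
      rw [div_lt_iff₀ hε] at hn
      nlinarith
    rwa [(vna_isClosed M).closure_eq] at this
  have hsa : ∀ x ∈ N, IsSelfAdjoint x → x ∈ M := by
    intro x hx h
    have h1 := h.neg_algebraMap_norm_le_self
    have e : algebraMap ℝ (H →L[ℂ] H) ‖x‖ = (‖x‖ : ℂ) • 1 := by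
      rw [Algebra.algebraMap_eq_smul_one, Complex.coe_smul]
    rw [e] at h1
    have h2 : x + (‖x‖ : ℂ) • 1 ∈ M := by
      refine hpos _ (add_mem hx (vna_smul_mem N _ (one_mem N))) ?_
      have := sub_nonneg.2 h1
      rwa [sub_neg_eq_add] at this
    have := sub_mem h2 (vna_smul_mem M (‖x‖ : ℂ) (one_mem M))
    simpa using this
  have e : x = (2⁻¹ : ℂ) • (x + star x) + (-(2⁻¹ * Complex.I)) • (Complex.I • (x - star x)) := by
    have hI : -(2⁻¹ * Complex.I) * Complex.I = 2⁻¹ := by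
      rw [neg_mul, mul_assoc, Complex.I_mul_I]; simp
    rw [smul_smul, hI]
    module
  rw [e]
  have hs := star_mem hx
  refine add_mem (vna_smul_mem M _ (hsa _ (add_mem hx hs) ?_))
    (vna_smul_mem M _ (hsa _ (vna_smul_mem N _ (sub_mem hx hs)) ?_))
  · simp [IsSelfAdjoint, add_comm]
  · rw [IsSelfAdjoint, star_smul, star_sub, star_star, RCLike.star_def, Complex.conj_I]; module

lemma vna_intertwiner (M : VonNeumannAlgebra H) (Ψ Φ : H)
    (h : ∀ a ∈ M, ⟪Ψ, a Ψ⟫_ℂ = ⟪Φ, a Φ⟫_ℂ) : ∃ w ∈ M.commutant, ‖w‖ ≤ 1 ∧ w Φ = Ψ := by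
  let S : Submodule ℂ (H →L[ℂ] H) := M.toStarSubalgebra.toSubalgebra.toSubmodule
  let T : H → S →ₗ[ℂ] H := fun v => (ContinuousLinearMap.apply ℂ H v).toLinearMap ∘ₗ S.subtype
  let K : Submodule ℂ H := (LinearMap.range (T Φ)).topologicalClosure
  have hKc : IsClosed (K : Set H) := Submodule.isClosed_topologicalClosure _
  have : CompleteSpace K := hKc.completeSpace_coe
  let e : S →ₗ[ℂ] K := (T Φ).codRestrict K
    (fun c => Submodule.le_topologicalClosure _ (LinearMap.mem_range_self _ c))
  have hnorm : ∀ a ∈ M, ‖a Ψ‖ = ‖a Φ‖ := by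
    intro a ha
    have h1 := h (star a * a) (mul_mem (star_mem ha) ha)
    have h2 : ∀ v : H, ⟪v, (star a * a) v⟫_ℂ = (‖a v‖ : ℂ) ^ 2 := by
      intro v
      rw [mul_apply_eq_comp, ContinuousLinearMap.star_eq_adjoint,
        ContinuousLinearMap.adjoint_inner_right, inner_self_eq_norm_sq_to_K]
      rfl
    rw [h2, h2] at h1
    have h3 : ‖a Ψ‖ ^ 2 = ‖a Φ‖ ^ 2 := by exact_mod_cast h1
    exact (pow_left_inj₀ (norm_nonneg _) (norm_nonneg _) two_ne_zero).1 h3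
  have hen : ∀ a : S, ‖T Ψ a‖ ≤ 1 * ‖e a‖ := by
    intro a
    rw [one_mul]
    exact (hnorm a.1 a.2).le
  have hdense : DenseRange e := by
    intro k
    rw [closure_subtype]
    have : Subtype.val '' Set.range e = Set.range (T Φ) := by
      rw [← Set.range_comp]; rfl
    rw [this]
    exact k.2
  let g : K →L[ℂ] H := (T Ψ).extendOfNorm e
  have hg : ∀ a : S, g (e a) = T Ψ a := LinearMap.extendOfNorm_eq hdense ⟨1, hen⟩
  have hgn : ∀ k, ‖g k‖ ≤ 1 * ‖k‖ := LinearMap.norm_extendOfNorm_apply_le hdense 1 hen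
  have hinv : ∀ a ∈ M, ∀ k ∈ K, a k ∈ K := by
    intro a ha k hk
    have : Set.MapsTo a (Set.range (T Φ)) (Set.range (T Φ)) := by
      rintro _ ⟨b, rfl⟩
      exact ⟨⟨a * b.1, M.mul_mem' ha b.2⟩, rfl⟩
    exact this.closure a.continuous hk
  have hgc : ∀ a (ha : a ∈ M), ∀ k : K, g ⟨a k, hinv a ha k k.2⟩ = a (g k) := by
    intro a ha k
    refine hdense.induction_on (p := fun k : K => g ⟨a k, hinv a ha k k.2⟩ = a (g k)) k ?_ ?_
    · exact isClosed_eq (by fun_prop) (by fun_prop)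
    · intro b
      rw [hg]
      exact hg ⟨a * b.1, M.mul_mem' ha b.2⟩
  have hp : K.starProjection ∈ M.commutant := by
    refine vna_starProjection_mem _ K ?_
    rw [VonNeumannAlgebra.commutant_commutant]
    exact hinv
  refine ⟨g ∘L K.orthogonalProjectionOnto, ?_, ?_, ?_⟩
  · rw [VonNeumannAlgebra.mem_commutant_iff]
    intro a ha
    ext x
    have h1 := DFunLike.congr_fun (VonNeumannAlgebra.mem_commutant_iff.1 hp a ha) x
    change a (g (K.orthogonalProjectionOnto x)) = g (K.orthogonalProjectionOnto (a x))
    rw [← hgc a ha]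
    congr 1
    exact Subtype.ext h1
  · refine ContinuousLinearMap.opNorm_le_bound _ zero_le_one ?_
    intro x
    refine (hgn _).trans ?_
    rw [one_mul, one_mul]
    exact Submodule.norm_orthogonalProjectionOnto_apply_le K x
  · have h1 : (e ⟨1, one_mem M⟩ : H) = Φ := rfl
    change g (K.orthogonalProjectionOnto Φ) = Ψ
    conv_lhs => rw [← h1]
    rw [Submodule.orthogonalProjectionOnto_mem_subspace_eq_self, hg]
    rfl

lemma uhlmann_proj (M_A M_B : VonNeumannAlgebra H) (hU : UhlmannProperty M_A M_B)
    (p : H →L[ℂ] H) (hp : p ∈ M_B.commutant) (hpp : IsStarProjection p) : p ∈ M_A := by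
  rw [VonNeumannAlgebra.IsStarProjection.mem_iff hpp]
  have hps : star p = p := hpp.isSelfAdjoint
  have hpi : ∀ x, p (p x) = p x := fun x => DFunLike.congr_fun hpp.isIdempotentElem x
  have hin : ∀ x y, ⟪p x, y⟫_ℂ = ⟪x, p y⟫_ℂ := by
    intro x y
    rw [← ContinuousLinearMap.adjoint_inner_right, ← ContinuousLinearMap.star_eq_adjoint, hps]
  have hcon : ∀ x, ‖p x‖ ^ 2 + ‖x - p x‖ ^ 2 = ‖x‖ ^ 2 := by
    intro x
    have h0 : ⟪p x, x - p x⟫_ℂ = 0 := by rw [hin, map_sub, hpi, sub_self, inner_zero_right]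
    have := norm_add_sq_eq_norm_sq_add_norm_sq_of_inner_eq_zero _ _ h0
    rw [add_sub_cancel] at this
    nlinarith
  have key : ∀ v ∈ M_A.commutant, star v * v = 1 → ∀ x, ‖x‖ = 1 → p x = x → p (v x) = v x := by
    intro v hv hv1 x hx hpx
    have hvi : ∀ y z, ⟪v y, v z⟫_ℂ = ⟪y, z⟫_ℂ := by
      intro y z
      rw [← ContinuousLinearMap.adjoint_inner_right, ← ContinuousLinearMap.star_eq_adjoint,
        ← mul_apply_eq_comp, hv1]
      rfl
    have hvn : ‖v x‖ = 1 := by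
      have := hvi x x
      rw [inner_self_eq_norm_sq_to_K, inner_self_eq_norm_sq_to_K, hx] at this
      have h3 : ‖v x‖ ^ 2 = 1 ^ 2 := by exact_mod_cast this
      exact (pow_left_inj₀ (norm_nonneg _) zero_le_one two_ne_zero).1 h3
    have hge : 1 ≤ ‖p (v x)‖ := by
      refine le_of_forall_sub_le ?_
      intro ε hε
      obtain ⟨u, hu, hu1, -, h⟩ := hU (v x) x hvn hx (by
        intro a ha
        have : a (v x) = v (a x) :=
          DFunLike.congr_fun (VonNeumannAlgebra.mem_commutant_iff.1 hv a ha) x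
        rw [this, hvi]) ε hε
      have hun : ‖u x‖ = 1 := by
        have h4 : ⟪u x, u x⟫_ℂ = ⟪x, x⟫_ℂ := by
          rw [← ContinuousLinearMap.adjoint_inner_right, ← ContinuousLinearMap.star_eq_adjoint,
            ← mul_apply_eq_comp, hu1]
          rfl
        rw [inner_self_eq_norm_sq_to_K, inner_self_eq_norm_sq_to_K, hx] at h4
        have h3 : ‖u x‖ ^ 2 = 1 ^ 2 := by exact_mod_cast h4
        exact (pow_left_inj₀ (norm_nonneg _) zero_le_one two_ne_zero).1 h3
      have hpu : p (u x) = u x := by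
        have : u (p x) = p (u x) :=
          DFunLike.congr_fun (VonNeumannAlgebra.mem_commutant_iff.1 hp u hu) x
        rw [← this, hpx]
      rw [← hpu, ← hin] at h
      have := norm_inner_le_norm (𝕜 := ℂ) (p (v x)) (u x)
      rw [hun, mul_one] at this
      linarith
    have := hcon (v x)
    rw [hvn] at this
    have h5 : ‖v x - p (v x)‖ ^ 2 = 0 := by nlinarith [sq_nonneg ‖v x - p (v x)‖]
    have h6 := norm_eq_zero.1 (pow_eq_zero_iff two_ne_zero |>.1 h5)
    exact (sub_eq_zero.1 h6).symm
  have key2 : ∀ v ∈ M_A.commutant, star v * v = 1 → ∀ x, p x = x → p (v x) = v x := by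
    intro v hv hv1 x hpx
    by_cases hx : x = 0
    · simp [hx]
    have hn : (‖x‖ : ℂ) ≠ 0 := by simpa using hx
    have := key v hv hv1 ((‖x‖ : ℂ)⁻¹ • x) (by simp [norm_smul, hx]) (by rw [map_smul, hpx])
    rw [map_smul, map_smul] at this
    exact smul_right_injective H (inv_ne_zero hn) this
  have key3 : ∀ y ∈ M_A.commutant, ∀ x, p x = x → p (y x) = y x := by
    intro y hy
    refine vna_le_of_unitary M_A.commutant (fun y => ∀ x, p x = x → p (y x) = y x)
      ?_ ?_ ?_ ?_ y hy
    · intro x _; simp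
    · intro y z h1 h2 x hx
      simp [h1 x hx, h2 x hx]
    · intro c y h1 x hx
      simp [h1 x hx]
    · intro u hu h1 _ x hx
      exact key2 u hu h1 x hx
  intro y hy
  rw [Module.End.mem_invtSubmodule]
  rintro _ ⟨x, rfl⟩
  exact ⟨_, key3 y hy _ (hpi x)⟩

end Helpers

/-- Uhlmann property ↔ Haag duality. -/
theorem uhlmann_iff_haag_duality {H : Type*} [NormedAddCommGroup H]
    [InnerProductSpace ℂ H] [CompleteSpace H]
    (M_A M_B : VonNeumannAlgebra H)
    (hcomm : ∀ a ∈ M_A, ∀ b ∈ M_B, a * b = b * a) :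
    UhlmannProperty M_A M_B ↔ M_B = M_A.commutant := by
  constructor
  · intro hU
    ext x
    constructor
    · intro hx
      rw [VonNeumannAlgebra.mem_commutant_iff]
      intro a ha
      exact hcomm a ha x hx
    · intro hx
      rw [← VonNeumannAlgebra.commutant_commutant M_B, VonNeumannAlgebra.mem_commutant_iff]
      intro g hg
      have := vna_le_of_proj M_B.commutant M_A (uhlmann_proj M_A M_B hU) g hg
      exact VonNeumannAlgebra.mem_commutant_iff.1 hx g this
  · rintro rfl
    intro Ψ Φ hΨ hΦ hst ε hε
    obtain ⟨w, hw, hwn, hwΦ⟩ := vna_intertwiner M_A Ψ Φ hst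
    obtain ⟨r, hr0, hr1, hr⟩ : ∃ r : ℝ, 0 ≤ r ∧ r < 1 ∧ 1 - ε / 2 ≤ r := by
      refine ⟨max 0 (1 - ε / 2), le_max_left _ _, max_lt one_pos (by linarith), le_max_right _ _⟩
    have hrw : ‖(r : ℂ) • w‖ < 1 := by
      rw [norm_smul, Complex.norm_real, Real.norm_of_nonneg hr0]
      nlinarith [norm_nonneg w]
    obtain ⟨u, hu, h1, h2, h3⟩ := vna_unitary_sup M_A.commutant Ψ Φ _ (vna_smul_mem _ (r : ℂ) hw)
      hrw (ε / 2) (by linarith)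
    refine ⟨u, hu, h1, h2, ?_⟩
    have h4 : ⟪Ψ, ((r : ℂ) • w) Φ⟫_ℂ = r := by
      rw [ContinuousLinearMap.smul_apply, hwΦ, inner_smul_right, inner_self_eq_norm_sq_to_K, hΨ]
      simp
    rw [h4, Complex.ofReal_re] at h3
    have := Complex.re_le_norm (⟪Ψ, u Φ⟫_ℂ)
    linarith
end

section
/- Let H be a complex Hilbert space and let M_A and M_B be commuting von Neumann algebras on H satisfying Haag duality M_B = M_A.commutant. Then the pair (M_A, M_B) has the Uhlmann property: for all unit vectors Ψ, Φ ∈ H with ⟪Ψ, a Ψ⟫ = ⟪Φ, a Φ⟫ for all a ∈ M_A, and every ε > 0, there exists u ∈ M_B with star u * u = 1 and u * star u = 1 such that ‖⟪Ψ, u Φ⟫‖ ≥ 1 − ε. -/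
open scoped InnerProductSpace

section UhlmannHelpers

/-- An invertible contraction is the mean of two unitaries. -/
lemma uhlmann_mean_two_unitaries {A : Type*} [CStarAlgebra A] (y : A) (hy : IsUnit y)
    (hn : ‖y‖ ≤ 1) : ∃ u₁ ∈ unitary A, ∃ u₂ ∈ unitary A, y + y = u₁ + u₂ := by
  let _ := CStarAlgebra.spectralOrder A
  let _ := CStarAlgebra.spectralOrderedRing A
  have hbb : CFC.abs y * CFC.abs y = star y * y := CFC.abs_mul_abs y
  have hsa : IsSelfAdjoint (CFC.abs y) := (CFC.abs_nonneg y).isSelfAdjoint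
  have hbn : ‖CFC.abs y‖ ≤ 1 := by rw [CFC.norm_abs]; exact hn
  have hbu : IsUnit (CFC.abs y) := by
    have h : IsUnit (CFC.abs y ^ 2) := by
      rw [sq, hbb]; exact hy.star.mul hy
    exact (isUnit_pow_iff two_ne_zero).1 h
  obtain ⟨b, hb⟩ := hbu
  rw [← hb] at hbb hsa hbn
  have hsi : star (↑b⁻¹ : A) = ↑b⁻¹ := by
    have h : star b = b := Units.ext hsa
    calc star (↑b⁻¹ : A) = ↑(star b)⁻¹ := by rw [← Units.coe_star_inv]
      _ = _ := by rw [h]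
  have hw1 : star (y * ↑b⁻¹) * (y * ↑b⁻¹) = 1 := by
    rw [star_mul, hsi]
    calc (↑b⁻¹ : A) * star y * (y * ↑b⁻¹) = ↑b⁻¹ * (star y * y) * ↑b⁻¹ := by
          simp only [mul_assoc]
      _ = 1 := by rw [← hbb]; simp
  have hw : y * ↑b⁻¹ ∈ unitary A := by
    refine Unitary.mem_iff.2 ⟨hw1, ?_⟩
    have hu : IsUnit (y * (↑b⁻¹ : A)) := hy.mul (Units.isUnit _)
    obtain ⟨w, hw⟩ := hu
    rw [← hw] at hw1 ⊢
    rw [Units.eq_inv_of_mul_eq_one_right hw1]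
    simp
  let a : selfAdjoint A := ⟨b, hsa⟩
  have ha : ‖a‖ ≤ 1 := hbn
  let v := selfAdjoint.unitarySelfAddISMul a ha
  refine ⟨y * ↑b⁻¹ * v, mul_mem hw v.2, y * ↑b⁻¹ * star v, mul_mem hw (star v).2, ?_⟩
  rw [← mul_add, Unitary.coe_star]
  have : (v : A) + star (v : A) = b + b := by
    rw [show star (v : A) = _ from selfAdjoint.star_coe_unitarySelfAddISMul a ha,
      show (v : A) = _ from selfAdjoint.unitarySelfAddISMul_coe a ha]
    simp [a]
  rw [this, mul_add]
  simp [mul_assoc]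

/-- A weak form of the Russo-Dye theorem. -/
lemma uhlmann_russo_dye {A : Type*} [CStarAlgebra A] (f : A →L[ℂ] ℂ) (x : A)
    (hx : ‖x‖ < 1) (δ : ℝ) (hδ : 0 < δ) :
    ∃ u ∈ unitary A, (f x).re - δ < (f u).re := by
  by_contra! hcon
  let S : Set ℝ := (fun u : A => (f u).re) '' (unitary A : Set A)
  have hne : S.Nonempty := ⟨_, 1, one_mem _, rfl⟩
  have hbd : BddAbove S := ⟨(f x).re - δ, by rintro _ ⟨u, hu, rfl⟩; exact hcon u hu⟩
  have h1 : sSup S ≤ (f x).re - δ := csSup_le hne (by rintro _ ⟨u, hu, rfl⟩; exact hcon u hu)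
  have h2 : ∀ u ∈ unitary A, (f u).re ≤ sSup S := fun u hu => le_csSup hbd ⟨u, hu, rfl⟩
  have h3 : sSup S ≤ 2 * sSup S - (f x).re := by
    apply csSup_le hne
    rintro _ ⟨u, hu, rfl⟩
    have hu' := Unitary.mem_iff.1 hu
    have hun : ‖u‖ ≤ 1 := by
      nontriviality A
      exact (CStarRing.norm_of_mem_unitary hu).le
    have hyu : IsUnit (u + x) := by
      have e : u + x = u * (1 - (-(star u * x))) := by
        rw [sub_neg_eq_add, mul_add, ← mul_assoc, hu'.2]; simp
      rw [e]
      refine IsUnit.mul ⟨⟨u, star u, hu'.2, hu'.1⟩, rfl⟩ (isUnit_one_sub_of_norm_lt_one ?_)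
      rw [norm_neg]
      calc ‖star u * x‖ ≤ ‖star u‖ * ‖x‖ := norm_mul_le _ _
        _ ≤ 1 * ‖x‖ := by rw [norm_star]; gcongr
        _ < 1 := by simpa using hx
    have hy2 : IsUnit ((2⁻¹ : ℂ) • (u + x)) := by
      have := hyu.smul (Units.mk0 (2⁻¹ : ℂ) (by norm_num))
      simpa [Units.smul_def] using this
    have hyn : ‖(2⁻¹ : ℂ) • (u + x)‖ ≤ 1 := by
      rw [norm_smul]
      have := norm_add_le u x
      norm_num
      linarith
    obtain ⟨u₁, hu₁, u₂, hu₂, he⟩ := uhlmann_mean_two_unitaries _ hy2 hyn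
    have he' : u + x = u₁ + u₂ := by
      rw [← he]; module
    have := congrArg (fun z => (f z).re) he'
    simp only [map_add, Complex.add_re] at this
    have := h2 _ hu₁
    have := h2 _ hu₂
    linarith
  linarith

/-- Vectors inducing the same state on `M` are related by a contraction in the commutant. -/
lemma uhlmann_exists_contraction {H : Type*} [NormedAddCommGroup H]
    [InnerProductSpace ℂ H] [CompleteSpace H] (M : VonNeumannAlgebra H) (Ψ Φ : H)
    (h : ∀ a ∈ M, inner ℂ Ψ (a Ψ) = inner ℂ Φ (a Φ)) :
    ∃ v ∈ M.commutant, ‖v‖ ≤ 1 ∧ v Φ = Ψ := by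
  let E := M.toStarSubalgebra
  let ev : H → (E →ₗ[ℂ] H) := fun ξ =>
    { toFun := fun a => (a : H →L[ℂ] H) ξ
      map_add' := fun _ _ => rfl
      map_smul' := fun _ _ => rfl }
  let K : Submodule ℂ H := (LinearMap.range (ev Φ)).topologicalClosure
  have hKc : IsClosed (K : Set H) := Submodule.isClosed_topologicalClosure _
  have : CompleteSpace K := hKc.completeSpace_coe
  have hmem : ∀ a : E, ev Φ a ∈ K := fun a =>
    Submodule.le_topologicalClosure _ (LinearMap.mem_range_self _ a)
  let e : E →ₗ[ℂ] K := (ev Φ).codRestrict K hmem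
  have hdense : DenseRange e := by
    intro k
    rw [closure_subtype, ← Set.range_comp]
    exact k.2
  have hnorm : ∀ a : E, ‖ev Ψ a‖ ≤ 1 * ‖e a‖ := by
    intro a
    have h1 := h (star (a : H →L[ℂ] H) * a) (mul_mem (star_mem a.2) a.2)
    rw [one_mul]
    change ‖(a : H →L[ℂ] H) Ψ‖ ≤ ‖(a : H →L[ℂ] H) Φ‖
    simp only [mul_apply_eq_comp, ContinuousLinearMap.star_eq_adjoint,
      ContinuousLinearMap.adjoint_inner_right, inner_self_eq_norm_sq_to_K] at h1
    have h2 : ‖(a : H →L[ℂ] H) Ψ‖ ^ 2 = ‖(a : H →L[ℂ] H) Φ‖ ^ 2 := by exact_mod_cast h1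
    exact ((sq_eq_sq₀ (norm_nonneg _) (norm_nonneg _)).1 h2).le
  let w : K →L[ℂ] H := (ev Ψ).extendOfNorm e
  have hw : ∀ a : E, w (e a) = (a : H →L[ℂ] H) Ψ := fun a =>
    LinearMap.extendOfNorm_eq hdense ⟨1, hnorm⟩ a
  have hwn : ‖w‖ ≤ 1 := LinearMap.opNorm_extendOfNorm_le hdense zero_le_one hnorm
  let v : H →L[ℂ] H := w ∘L K.orthogonalProjectionOnto
  have hvK : ∀ k : K, v k = w k := fun k => by simp [v]
  have hva : ∀ a : E, v ((a : H →L[ℂ] H) Φ) = (a : H →L[ℂ] H) Ψ := fun a => by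
    rw [← hw a, ← hvK]; rfl
  have hinv : ∀ a : E, ∀ k ∈ K, (a : H →L[ℂ] H) k ∈ K := by
    intro a k hk
    have := map_mem_closure (t := (LinearMap.range (ev Φ) : Set H))
      (a : H →L[ℂ] H).continuous (show k ∈ closure (LinearMap.range (ev Φ) : Set H) from hk) ?_
    · exact this
    · rintro _ ⟨b, rfl⟩
      exact ⟨a * b, rfl⟩
  have hperp : ∀ k ∈ Kᗮ, v k = 0 := by
    intro k hk
    simp [v, Submodule.orthogonalProjectionOnto_eq_zero_iff.2 hk]
  refine ⟨v, ?_, ?_, ?_⟩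
  · rw [VonNeumannAlgebra.mem_commutant_iff]
    intro g hg
    let a : E := ⟨g, hg⟩
    have hK : ∀ k : K, g (v k) = v (g k) := by
      intro k
      refine hdense.induction (P := fun k : K => g (v k) = v (g k)) ?_ ?_ k
      · rintro _ ⟨b, rfl⟩
        change g (v ((b : H →L[ℂ] H) Φ)) = v (((a * b : E) : H →L[ℂ] H) Φ)
        rw [hva, hva]; rfl
      · exact isClosed_eq (by fun_prop) (by fun_prop)
    have hP : ∀ k ∈ Kᗮ, g (v k) = v (g k) := by
      intro k hk
      rw [hperp k hk, map_zero, hperp]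
      rw [Submodule.mem_orthogonal]
      intro z hz
      rw [← ContinuousLinearMap.adjoint_inner_left]
      exact Submodule.inner_right_of_mem_orthogonal (hinv (star a) z hz) hk
    ext z
    obtain ⟨p, hp, q, hq, rfl⟩ := K.exists_add_mem_mem_orthogonal z
    simp only [mul_apply_eq_comp, map_add]
    rw [hP q hq, hK ⟨p, hp⟩]
  · calc ‖v‖ ≤ ‖w‖ * ‖K.orthogonalProjectionOnto‖ := ContinuousLinearMap.opNorm_comp_le _ _
      _ ≤ 1 * 1 := by
        gcongr
        exact K.orthogonalProjectionOnto_norm_le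
      _ = 1 := one_mul 1
  · simpa using hva 1

end UhlmannHelpers

/-- Haag duality implies the Uhlmann property. -/
theorem uhlmann_of_haagDuality {H : Type*} [NormedAddCommGroup H]
    [InnerProductSpace ℂ H] [CompleteSpace H]
    (M_A M_B : VonNeumannAlgebra H)
    (hcomm : ∀ a ∈ M_A, ∀ b ∈ M_B, a * b = b * a)
    (hhaag : M_B = M_A.commutant) :
    UhlmannProperty M_A M_B := by
  intro Ψ Φ hΨ hΦ h ε hε
  obtain ⟨v, hv, hvn, hvΦ⟩ := uhlmann_exists_contraction M_A Ψ Φ h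
  rw [← hhaag] at hv
  have hclosed : IsClosed (M_B.toStarSubalgebra : Set (H →L[ℂ] H)) := by
    rw [VonNeumannAlgebra.coe_toStarSubalgebra, hhaag, VonNeumannAlgebra.coe_commutant]
    exact Set.isClosed_centralizer _
  have : IsClosed (M_B.toStarSubalgebra : Set (H →L[ℂ] H)) := hclosed
  let A := M_B.toStarSubalgebra
  let _ : CStarAlgebra A := StarSubalgebra.cstarAlgebra A
  let f : A →L[ℂ] ℂ :=
    ((innerSL ℂ Ψ) ∘L (ContinuousLinearMap.apply ℂ H Φ)) ∘L A.toSubalgebra.toSubmodule.subtypeL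
  have hf : ∀ a : A, f a = inner ℂ Ψ ((a : H →L[ℂ] H) Φ) := fun a => rfl
  let r : ℝ := 1 - min (ε / 2) 1
  have hr0 : 0 ≤ r := sub_nonneg.2 (min_le_right _ _)
  have hr1 : r < 1 := by simp [r, hε]
  have hrε : 1 - ε / 2 ≤ r := sub_le_sub_left (min_le_left _ _) 1
  let x : A := (r : ℂ) • ⟨v, hv⟩
  have hx : ‖x‖ < 1 := by
    have : ‖x‖ ≤ r * ‖v‖ := by
      rw [norm_smul, Complex.norm_real, Real.norm_of_nonneg hr0]; rfl
    nlinarith [norm_nonneg v]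
  obtain ⟨u, hu, hlt⟩ := uhlmann_russo_dye f x hx (ε / 2) (by positivity)
  have hfx : f x = r := by
    rw [map_smul, hf]
    simp [hvΦ, inner_self_eq_norm_sq_to_K, hΨ]
  rw [hfx, Complex.ofReal_re, hf] at hlt
  have hu' := Unitary.mem_iff.1 hu
  refine ⟨u, u.2, congrArg Subtype.val hu'.1, congrArg Subtype.val hu'.2, ?_⟩
  have := Complex.re_le_norm (inner ℂ Ψ ((u : H →L[ℂ] H) Φ))
  linarith
end

section
/- Let H be a complex Hilbert space and let M_A and M_B be von Neumann algebras on H that commute (a * b = b * a for all a ∈ M_A, b ∈ M_B). If the pair (M_A, M_B) has the Uhlmann property, then Haag duality holds: M_B = M_A.commutant. -/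
open scoped InnerProductSpace

section Helpers

variable {H : Type*} [NormedAddCommGroup H] [InnerProductSpace ℂ H] [CompleteSpace H]

lemma aux_norm_le {y : H →L[ℂ] H} (hy : IsSelfAdjoint y) {c : ℝ} (hc : 0 ≤ c)
    (h1 : -(algebraMap ℝ (H →L[ℂ] H) c) ≤ y) (h2 : y ≤ algebraMap ℝ (H →L[ℂ] H) c) :
    ‖y‖ ≤ c := by
  rw [← map_neg, algebraMap_le_iff_le_spectrum] at h1
  rw [le_algebraMap_iff_spectrum_le] at h2
  rw [← cfc_id ℝ y]
  refine norm_cfc_le hc fun t ht => ?_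
  rw [id, Real.norm_eq_abs, abs_le]
  exact ⟨h1 t ht, h2 t ht⟩

/-- A unitary of `M_A'` preserves closed subspaces invariant under `M_B`. -/
lemma aux_unitary {M_A M_B : VonNeumannAlgebra H}
    (hU : UhlmannProperty M_A M_B) (K : Submodule ℂ H) [K.HasOrthogonalProjection]
    (hK : ∀ b ∈ M_B, ∀ ψ ∈ K, b ψ ∈ K)
    (v : H →L[ℂ] H) (hv : v ∈ M_A.commutant) (hvv : star v * v = 1) :
    ∀ ψ ∈ K, v ψ ∈ K := by
  have hin : ∀ x y : H, ⟪v x, v y⟫_ℂ = ⟪x, y⟫_ℂ := by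
    intro x y
    rw [← ContinuousLinearMap.adjoint_inner_right, ← ContinuousLinearMap.star_eq_adjoint,
      ← ContinuousLinearMap.mul_apply, hvv, ContinuousLinearMap.one_apply]
  have hn : ∀ x : H, ‖v x‖ = ‖x‖ := by
    intro x
    rw [@norm_eq_sqrt_re_inner ℂ, @norm_eq_sqrt_re_inner ℂ _ _ _ _ x, hin]
  have key : ∀ ψ ∈ K, ‖ψ‖ = 1 → v ψ ∈ K := by
    intro ψ hψ h1
    rw [K.mem_iff_norm_starProjection, hn, h1]
    refine le_antisymm ?_ ?_
    · exact (K.norm_starProjection_apply_le _).trans (by rw [hn, h1])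
    refine le_of_forall_pos_le_add fun ε hε => ?_
    obtain ⟨u, hu, hu1, -, hu2⟩ := hU (v ψ) ψ (by rw [hn, h1]) h1 (fun a ha => by
      have : a (v ψ) = v (a ψ) := by
        have := VonNeumannAlgebra.mem_commutant_iff.1 hv a ha
        exact congr($this ψ)
      rw [this, hin]) ε hε
    have huψ : ‖u ψ‖ = 1 := by
      have : ⟪u ψ, u ψ⟫_ℂ = ⟪ψ, ψ⟫_ℂ := by
        rw [← ContinuousLinearMap.adjoint_inner_right, ← ContinuousLinearMap.star_eq_adjoint,
          ← ContinuousLinearMap.mul_apply, hu1, ContinuousLinearMap.one_apply]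
      rw [@norm_eq_sqrt_re_inner ℂ, this, ← @norm_eq_sqrt_re_inner ℂ, h1]
    have h3 : ⟪v ψ, u ψ⟫_ℂ = ⟪K.starProjection (v ψ), u ψ⟫_ℂ := by
      rw [K.inner_starProjection_left_eq_right,
        Submodule.starProjection_eq_self_iff.2 (hK u hu ψ hψ)]
    rw [h3] at hu2
    have := norm_inner_le_norm (𝕜 := ℂ) (K.starProjection (v ψ)) (u ψ)
    rw [huψ] at this
    linarith
  intro ψ hψ
  by_cases h0 : ψ = 0
  · simp [h0]
  have hne : (‖ψ‖ : ℂ) ≠ 0 := by simpa using h0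
  have := key ((‖ψ‖ : ℂ)⁻¹ • ψ) (K.smul_mem _ hψ) (by
    rw [norm_smul]; simp [h0])
  rw [map_smul] at this
  exact (K.smul_mem_iff (inv_ne_zero hne)).1 this

lemma aux_inv {M_A M_B : VonNeumannAlgebra H}
    (hU : UhlmannProperty M_A M_B) (K : Submodule ℂ H) [K.HasOrthogonalProjection]
    (hK : ∀ b ∈ M_B, ∀ ψ ∈ K, b ψ ∈ K)
    (y : H →L[ℂ] H) (hy : y ∈ M_A.commutant) :
    ∀ ψ ∈ K, y ψ ∈ K := by
  have hcl : IsClosed (M_A.commutant.toStarSubalgebra : Set (H →L[ℂ] H)) := by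
    rw [VonNeumannAlgebra.coe_toStarSubalgebra, VonNeumannAlgebra.coe_commutant]
    exact Set.isClosed_centralizer _
  have : IsClosed (M_A.commutant.toStarSubalgebra : Set (H →L[ℂ] H)) := hcl
  let _ : CStarAlgebra M_A.commutant.toStarSubalgebra := StarSubalgebra.cstarAlgebra _
  obtain ⟨u, c, h, -⟩ := CStarAlgebra.exists_sum_four_unitary
    (⟨y, hy⟩ : M_A.commutant.toStarSubalgebra)
  have h' : y = ∑ i, c i • ((u i : M_A.commutant.toStarSubalgebra) : H →L[ℂ] H) := by
    have := congrArg Subtype.val h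
    simpa using this
  intro ψ hψ
  rw [h', sum_apply]
  refine K.sum_mem fun i _ => K.smul_mem _ ?_
  refine aux_unitary hU K hK _ (u i).1.2 ?_ ψ hψ
  have := congrArg Subtype.val (Unitary.mem_iff.1 (u i).2).1
  exact this

/-- Halving step. -/
lemma aux_half {M_A M_B : VonNeumannAlgebra H}
    (hU : UhlmannProperty M_A M_B) (x : H →L[ℂ] H) (hx : IsSelfAdjoint x)
    (hxB : x ∈ M_B.commutant) :
    ∃ s ∈ M_A, x - s ∈ M_B.commutant ∧ IsSelfAdjoint (x - s) ∧ ‖x - s‖ ≤ ‖x‖ / 2 := by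
  set xp : H →L[ℂ] H := x⁺ with hxp
  set xm : H →L[ℂ] H := x⁻ with hxm
  have hxe : xp - xm = x := CFC.posPart_sub_negPart x hx
  have hmp : xm * xp = 0 := CFC.negPart_mul_posPart x
  have hp0 : 0 ≤ xp := CFC.posPart_nonneg x
  have hm0 : 0 ≤ xm := CFC.negPart_nonneg x
  have hps : star xp = xp := hp0.isSelfAdjoint.star_eq
  have hms : star xm = xm := hm0.isSelfAdjoint.star_eq
  have hpn : ‖xp‖ ≤ ‖x‖ := CStarAlgebra.norm_posPart_le x
  have hmn : ‖xm‖ ≤ ‖x‖ := CStarAlgebra.norm_negPart_le x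
  have hmB : ∀ b ∈ M_B, b * xm = xm * b := by
    intro b hb
    have h1 : Commute x b := (VonNeumannAlgebra.mem_commutant_iff.1 hxB b hb).symm
    have : Commute (cfcₙ (·⁻ : ℝ → ℝ) x) b := hx.commute_cfcₙ h1 _
    exact this.symm
  let K : Submodule ℂ H := LinearMap.ker (xm : H →ₗ[ℂ] H)
  have hKm : ∀ ψ, ψ ∈ K ↔ xm ψ = 0 := fun ψ => Iff.rfl
  have hKc : IsClosed (K : Set H) := ContinuousLinearMap.isClosed_ker xm
  have : CompleteSpace K := hKc.completeSpace_coe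
  have hK : ∀ b ∈ M_B, ∀ ψ ∈ K, b ψ ∈ K := by
    intro b hb ψ hψ
    rw [hKm] at *
    have : b (xm ψ) = xm (b ψ) := congr($(hmB b hb) ψ)
    rw [← this, hψ, map_zero]
  set p := K.starProjection with hp
  have hpP : IsStarProjection p := isStarProjection_starProjection
  have hpsa : star p = p := hpP.isSelfAdjoint.star_eq
  have hpp : p * p = p := hpP.isIdempotentElem
  have hrange : p.range = K := Submodule.range_starProjection K
  have hpA : p ∈ M_A := by
    rw [VonNeumannAlgebra.IsStarProjection.mem_iff hpP]
    intro y hy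
    rw [hrange]
    exact fun ψ hψ => aux_inv hU K hK y hy ψ hψ
  have hpB : p ∈ M_B.commutant := by
    rw [VonNeumannAlgebra.IsStarProjection.mem_iff hpP]
    intro y hy
    rw [VonNeumannAlgebra.commutant_commutant] at hy
    rw [hrange]
    exact fun ψ hψ => hK y hy ψ hψ
  have hpxp : p * xp = xp := by
    ext ψ
    exact Submodule.starProjection_eq_self_iff.2 ((hKm _).2 congr($hmp ψ))
  have hxpp : xp * p = xp := by simpa [hps, hpsa] using congrArg star hpxp
  have hxmp : xm * p = 0 := by
    ext ψ
    exact (hKm _).1 (Submodule.starProjection_apply_mem K ψ)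
  have hpxm : p * xm = 0 := by simpa [hms, hpsa] using congrArg star hxmp
  set r := ‖x‖ with hr
  have hr0 : 0 ≤ r := norm_nonneg _
  have hle1 : xp ≤ r • p := by
    have h := (CStarAlgebra.norm_le_iff_le_algebraMap xp hr0 hp0).1 hpn
    have h' := star_left_conjugate_le_conjugate h p
    rw [hpsa, hpxp, hxpp, Algebra.algebraMap_eq_smul_one] at h'
    simpa [hpp] using h'
  have hle2 : xm ≤ r • (1 - p) := by
    have h := (CStarAlgebra.norm_le_iff_le_algebraMap xm hr0 hm0).1 hmn
    have h' := star_left_conjugate_le_conjugate h (1 - p)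
    have e1 : star (1 - p) * xm * (1 - p) = xm := by
      simp [hpsa, sub_mul, hpxm, mul_sub, hxmp]
    have e2 : (1 - p) * (1 - p) = 1 - p := by
      simp [sub_mul, mul_sub, hpp]
    rw [e1, Algebra.algebraMap_eq_smul_one] at h'
    simpa [hpsa, e2] using h'
  have hsm : ∀ (M : VonNeumannAlgebra H), p ∈ M → (r / 2) • (2 * p - 1) ∈ M := by
    intro M hM
    have h2 : (2 * p - 1) ∈ M := by
      rw [two_mul]
      exact sub_mem (add_mem hM hM) (one_mem M)
    have := M.toStarSubalgebra.smul_mem (show _ ∈ M.toStarSubalgebra from h2) ((r / 2 : ℝ) : ℂ)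
    exact this
  have hsa : IsSelfAdjoint (x - (r / 2) • (2 * p - 1)) := by
    refine hx.sub ?_
    rw [two_mul]
    exact IsSelfAdjoint.smul (by simp [IsSelfAdjoint])
      ((hpP.isSelfAdjoint.add hpP.isSelfAdjoint).sub (IsSelfAdjoint.one _))
  refine ⟨(r / 2) • (2 * p - 1), hsm _ hpA, sub_mem hxB (hsm _ hpB), hsa, ?_⟩
  refine aux_norm_le hsa (by positivity) ?_ ?_
  · rw [Algebra.algebraMap_eq_smul_one, ← sub_nonneg]
    have : x - (r / 2) • (2 * p - 1) - -((r / 2) • (1 : H →L[ℂ] H))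
        = xp + (r • (1 - p) - xm) := by
      rw [← hxe, two_mul]; module
    rw [this]
    exact add_nonneg hp0 (sub_nonneg.2 hle2)
  · rw [Algebra.algebraMap_eq_smul_one, ← sub_nonneg]
    have : (r / 2) • (1 : H →L[ℂ] H) - (x - (r / 2) • (2 * p - 1))
        = xm + (r • p - xp) := by
      rw [← hxe, two_mul]; module
    rw [this]
    exact add_nonneg hm0 (sub_nonneg.2 hle1)

lemma aux_commute {M_A M_B : VonNeumannAlgebra H}
    (hU : UhlmannProperty M_A M_B) (y : H →L[ℂ] H) (hy : y ∈ M_A.commutant)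
    (x : H →L[ℂ] H) (hx : IsSelfAdjoint x) (hxB : x ∈ M_B.commutant) :
    x * y = y * x := by
  have main : ∀ n : ℕ, ∀ x : H →L[ℂ] H, IsSelfAdjoint x → x ∈ M_B.commutant →
      ‖x * y - y * x‖ ≤ 2 * ‖y‖ * ‖x‖ * (1 / 2) ^ n := by
    intro n
    induction n with
    | zero =>
      intro x _ _
      have h1 := norm_sub_le (x * y) (y * x)
      have h2 := norm_mul_le x y
      have h3 := norm_mul_le y x
      rw [pow_zero]
      nlinarith
    | succ n ih =>
      intro x hx hxB
      obtain ⟨s, hs, h1, h2, h3⟩ := aux_half hU x hx hxB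
      have h4 := ih _ h2 h1
      have h5 := VonNeumannAlgebra.mem_commutant_iff.1 hy s hs
      have h6 : (x - s) * y - y * (x - s) = x * y - y * x := by
        rw [sub_mul, mul_sub, h5]; abel
      rw [h6] at h4
      refine h4.trans ?_
      calc 2 * ‖y‖ * ‖x - s‖ * (1 / 2) ^ n ≤ 2 * ‖y‖ * (‖x‖ / 2) * (1 / 2) ^ n := by gcongr
        _ = _ := by ring
  have hlim : Filter.Tendsto (fun n : ℕ => 2 * ‖y‖ * ‖x‖ * (1 / 2 : ℝ) ^ n) Filter.atTop
      (nhds (2 * ‖y‖ * ‖x‖ * 0)) :=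
    (tendsto_pow_atTop_nhds_zero_of_lt_one (by norm_num) (by norm_num)).const_mul _
  have := ge_of_tendsto' hlim fun n => main n x hx hxB
  rw [mul_zero] at this
  exact sub_eq_zero.1 (norm_le_zero_iff.1 this)

end Helpers

/-- The Uhlmann property implies Haag duality. -/
theorem haagDuality_of_uhlmann {H : Type*} [NormedAddCommGroup H]
    [InnerProductSpace ℂ H] [CompleteSpace H]
    (M_A M_B : VonNeumannAlgebra H)
    (hcomm : ∀ a ∈ M_A, ∀ b ∈ M_B, a * b = b * a)
    (huhlmann : UhlmannProperty M_A M_B) :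
    M_B = M_A.commutant := by
  refine VonNeumannAlgebra.ext fun y => ⟨fun hy => ?_, fun hy => ?_⟩
  · exact VonNeumannAlgebra.mem_commutant_iff.2 fun a ha => hcomm a ha y hy
  · rw [← VonNeumannAlgebra.commutant_commutant M_B, VonNeumannAlgebra.mem_commutant_iff]
    intro x hx
    have hxs : star x ∈ M_B.commutant := star_mem hx
    have h1 := aux_commute huhlmann y hy (x + star x) (IsSelfAdjoint.add_star_self x)
      (add_mem hx hxs)
    have hI : Complex.I • (x - star x) ∈ M_B.commutant :=
      M_B.commutant.toStarSubalgebra.smul_mem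
        (show _ ∈ M_B.commutant.toStarSubalgebra from sub_mem hx hxs) Complex.I
    have h2 := aux_commute huhlmann y hy (Complex.I • (x - star x))
      (by
        rw [IsSelfAdjoint, star_smul, star_sub, star_star]
        simp [smul_sub]
        abel) hI
    rw [smul_mul_assoc, mul_smul_comm] at h2
    have h3 := smul_right_injective _ Complex.I_ne_zero h2
    have h4 : (2 : ℂ) • (x * y) = (2 : ℂ) • (y * x) := by
      have e1 : (2 : ℂ) • (x * y) = (x + star x) * y + (x - star x) * y := by
        rw [add_mul, sub_mul]; module
      have e2 : (2 : ℂ) • (y * x) = y * (x + star x) + y * (x - star x) := by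
        rw [mul_add, mul_sub]; module
      rw [e1, e2, h1]
      exact congrArg _ h3
    exact smul_right_injective _ (two_ne_zero) h4
end

section
/- Let H be a complex Hilbert space and let M_A and M_B be von Neumann algebras on H that commute (a * b = b * a for all a ∈ M_A, b ∈ M_B). Suppose that for every vector Ψ ∈ H, the topological closure of the linear span of {a Ψ | a ∈ M_A.commutant} equals the topological closure of the linear span of {b Ψ | b ∈ M_B}. Then Haag duality holds: M_B = M_A.commutant. -/
open scoped InnerProductSpace

section Helpers

variable {H : Type*} [NormedAddCommGroup H] [InnerProductSpace ℂ H] [CompleteSpace H]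

/-- An operator which, together with its adjoint, preserves `K` commutes with its projection. -/
lemma hd_commute_proj (K : Submodule ℂ H) [K.HasOrthogonalProjection] (b : H →L[ℂ] H)
    (h1 : ∀ v ∈ K, b v ∈ K) (h2 : ∀ v ∈ K, star b v ∈ K) :
    K.starProjection * b = b * K.starProjection := by
  have key : ∀ c : H →L[ℂ] H, (∀ v ∈ K, c v ∈ K) →
      K.starProjection * (c * K.starProjection) = c * K.starProjection := by
    intro c hc
    ext v
    simp only [mul_apply_eq_comp]
    exact Submodule.starProjection_eq_self_iff.2 (hc _ (Submodule.starProjection_apply_mem _ _))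
  have hs : star K.starProjection = K.starProjection :=
    (isStarProjection_starProjection (U := K)).isSelfAdjoint
  have e1 := key b h1
  have e2 := congrArg star (key (star b) h2)
  simp only [star_mul, star_star, hs] at e2
  rw [← e2, mul_assoc, e1]

/-- One step of the binary expansion. -/
lemma hd_step (x : H →L[ℂ] H) (hx0 : 0 ≤ x) (hx1 : x ≤ 1) :
    ∃ q y : H →L[ℂ] H, 0 ≤ 2 * x - 1 + q ∧ 2 * x - 1 + q ≤ 1 ∧
      (∀ b, Commute x b → Commute y b) ∧
      (∀ b : H →L[ℂ] H, (∀ v, y v = 0 → y (b v) = 0) → (∀ v, y v = 0 → y (star b v) = 0) →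
        Commute q b) := by
  have hxs : IsSelfAdjoint x := IsSelfAdjoint.of_nonneg hx0
  obtain ⟨y, hy⟩ : ∃ y, y = 2 * x - 1 := ⟨_, rfl⟩
  have hys : IsSelfAdjoint y := by
    rw [hy, two_mul]; exact (hxs.add hxs).sub (IsSelfAdjoint.one _)
  have hpn := CFC.posPart_sub_negPart y hys
  have hp0 : 0 ≤ y⁺ := CFC.posPart_nonneg y
  have hn0 : 0 ≤ y⁻ := CFC.negPart_nonneg y
  have hps : star y⁺ = y⁺ := IsSelfAdjoint.of_nonneg hp0
  have hns : star y⁻ = y⁻ := IsSelfAdjoint.of_nonneg hn0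
  have hmul := CFC.posPart_mul_negPart y
  let K : Submodule ℂ H := LinearMap.ker (y⁺ : H →L[ℂ] H).toLinearMap
  have hK : IsClosed (K : Set H) := (y⁺ : H →L[ℂ] H).isClosed_ker
  have : CompleteSpace K := hK.completeSpace_coe
  have memK : ∀ v, v ∈ K ↔ y⁺ v = 0 := fun v => Iff.rfl
  obtain ⟨q, hq⟩ : ∃ q, q = K.starProjection := ⟨_, rfl⟩
  have hqs : IsSelfAdjoint q := hq ▸ (isStarProjection_starProjection (U := K)).isSelfAdjoint
  have hqq : q * q = q := hq ▸ (isStarProjection_starProjection (U := K)).isIdempotentElem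
  have a1 : y⁺ * q = 0 := by
    ext v
    rw [hq]
    exact (memK _).1 (Submodule.starProjection_apply_mem K v)
  have a2 : q * y⁺ = 0 := by
    have := congrArg star a1
    simpa [star_mul, hps, hqs.star_eq] using this
  have b1 : q * y⁻ = y⁻ := by
    ext v
    rw [hq]
    refine Submodule.starProjection_eq_self_iff.2 ((memK _).2 ?_)
    exact congrArg (fun T : H →L[ℂ] H => T v) hmul
  have b2 : y⁻ * q = y⁻ := by
    have := congrArg star b1
    simpa [star_mul, hns, hqs.star_eq] using this
  have c1 : q * y = -y⁻ := by
    calc q * y = q * (y⁺ - y⁻) := by rw [hpn]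
      _ = -y⁻ := by rw [mul_sub, a2, b1, zero_sub]
  have c2 : y * q = -y⁻ := by
    calc y * q = (y⁺ - y⁻) * q := by rw [hpn]
      _ = -y⁻ := by rw [sub_mul, a1, b2, zero_sub]
  have hyp : y⁺ = y + y⁻ := sub_eq_iff_eq_add.1 hpn
  have hx2 : x + x = y + 1 := by rw [hy, two_mul]; abel
  refine ⟨q, y⁺, ?_, ?_, ?_, ?_⟩
  · have h : 0 ≤ y⁺ + q * (x + x) * q :=
      add_nonneg hp0 (hqs.conjugate_nonneg (add_nonneg hx0 hx0))
    convert h using 1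
    rw [← hy, hx2]
    simp only [mul_add, add_mul, c1, neg_mul, b2, mul_one, hqq]
    rw [hyp]
    abel
  · have h1 : 0 ≤ 1 - x := sub_nonneg.2 hx1
    have h : 0 ≤ y⁻ + (1 - q) * ((1 - x) + (1 - x)) * (1 - q) :=
      add_nonneg hn0 (((IsSelfAdjoint.one _).sub hqs).conjugate_nonneg (add_nonneg h1 h1))
    rw [← sub_nonneg]
    convert h using 1
    have : (1 - x) + (1 - x) = 1 - y := by rw [hy, two_mul]; abel
    rw [← hy, this]
    simp only [mul_sub, sub_mul, c1, c2, neg_mul, b2, mul_one, one_mul, hqq]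
    abel
  · intro b hb
    have : Commute y b := by
      rw [hy, two_mul]
      exact (hb.add_left hb).sub_left (Commute.one_left b)
    rw [CFC.posPart_def]
    exact this.cfcₙ_real _
  · intro b h1 h2
    rw [hq]
    exact hd_commute_proj K b h1 h2

lemma hd_bound (S : VonNeumannAlgebra H) (n : H →L[ℂ] H)
    (hn : ∀ y ∈ S.commutant, ∀ v, y v = 0 → y (n v) = 0 ∧ y (star n v) = 0) (k : ℕ) :
    ∀ x ∈ S.commutant, 0 ≤ x → x ≤ 1 → ‖x * n - n * x‖ ≤ 2 * ‖n‖ * (1 / 2) ^ k := by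
  induction k with
  | zero =>
    intro x _ hx0 hx1
    have h1 : ‖x‖ ≤ 1 := (CStarAlgebra.norm_le_one_iff_of_nonneg x hx0).2 hx1
    have := norm_sub_le (x * n) (n * x)
    have h2 := norm_mul_le x n
    have h3 := norm_mul_le n x
    nlinarith [norm_nonneg n]
  | succ k ih =>
    intro x hx hx0 hx1
    obtain ⟨q, y, h0, h1, hy, hq⟩ := hd_step x hx0 hx1
    have hyS : y ∈ S.commutant := by
      rw [VonNeumannAlgebra.mem_commutant_iff] at hx ⊢
      intro b hb
      exact (hy b (hx b hb).symm).symm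
    have hqn : Commute q n :=
      hq n (fun v hv => (hn y hyS v hv).1) (fun v hv => (hn y hyS v hv).2)
    have hqS : q ∈ S.commutant := by
      rw [VonNeumannAlgebra.mem_commutant_iff]
      have hpres : ∀ b ∈ S, ∀ v, y v = 0 → y (b v) = 0 := by
        intro b hb v hv
        have := congrArg (fun T : H →L[ℂ] H => T v)
          (VonNeumannAlgebra.mem_commutant_iff.1 hyS b hb)
        simp only [mul_apply_eq_comp, hv, map_zero] at this
        exact this.symm
      intro b hb
      exact (hq b (hpres b hb) (hpres _ (star_mem hb))).symm
    have hz : 2 * x - 1 + q ∈ S.commutant := by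
      rw [two_mul]
      exact add_mem (sub_mem (add_mem hx hx) (one_mem _)) hqS
    have := ih _ hz h0 h1
    have e : (2 * x - 1 + q) * n - n * (2 * x - 1 + q) = (2 : ℝ) • (x * n - n * x) := by
      rw [two_smul, two_mul]
      simp only [mul_add, add_mul, mul_sub, sub_mul, one_mul, mul_one, hqn.eq]
      abel
    rw [e, norm_smul, Real.norm_ofNat] at this
    rw [pow_succ]
    linarith

lemma hd_commute_contr (S : VonNeumannAlgebra H) (n : H →L[ℂ] H)
    (hn : ∀ y ∈ S.commutant, ∀ v, y v = 0 → y (n v) = 0 ∧ y (star n v) = 0)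
    (x : H →L[ℂ] H) (hx : x ∈ S.commutant) (h0 : 0 ≤ x) (h1 : x ≤ 1) : Commute x n := by
  have hlim : Filter.Tendsto (fun k : ℕ => 2 * ‖n‖ * (1 / 2 : ℝ) ^ k) Filter.atTop (nhds 0) := by
    simpa using (tendsto_pow_atTop_nhds_zero_of_lt_one (by norm_num : (0 : ℝ) ≤ 1 / 2)
      (by norm_num)).const_mul (2 * ‖n‖)
  have := ge_of_tendsto' hlim (fun k => hd_bound S n hn k x hx h0 h1)
  exact sub_eq_zero.1 (norm_le_zero_iff.1 this)

lemma hd_commute_nonneg (S : VonNeumannAlgebra H) (n : H →L[ℂ] H)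
    (hn : ∀ y ∈ S.commutant, ∀ v, y v = 0 → y (n v) = 0 ∧ y (star n v) = 0)
    (x : H →L[ℂ] H) (hx : ∀ b ∈ S, Commute x b) (h0 : 0 ≤ x) : Commute x n := by
  by_cases hz : x = 0
  · subst hz; exact Commute.zero_left n
  have hnz : ‖x‖ ≠ 0 := norm_ne_zero_iff.2 hz
  have hpos : 0 ≤ ‖x‖⁻¹ • x := smul_nonneg (by positivity) h0
  have hle : ‖x‖⁻¹ • x ≤ 1 := by
    rw [← CStarAlgebra.norm_le_one_iff_of_nonneg _ hpos, norm_smul, norm_inv, norm_norm,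
      inv_mul_cancel₀ hnz]
  have hmem : ‖x‖⁻¹ • x ∈ S.commutant := by
    rw [VonNeumannAlgebra.mem_commutant_iff]
    intro b hb
    exact ((hx b hb).smul_left _).symm
  have := (hd_commute_contr S n hn _ hmem hpos hle).smul_left ‖x‖
  rwa [smul_smul, mul_inv_cancel₀ hnz, one_smul] at this

lemma hd_commute_all (S : VonNeumannAlgebra H) (n : H →L[ℂ] H)
    (hn : ∀ y ∈ S.commutant, ∀ v, y v = 0 → y (n v) = 0 ∧ y (star n v) = 0)
    (x : H →L[ℂ] H) (hx : x ∈ S.commutant) : Commute x n := by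
  have hc : ∀ b ∈ S, Commute x b := fun b hb =>
    (VonNeumannAlgebra.mem_commutant_iff.1 hx b hb).symm
  have hc' : ∀ b ∈ S, Commute (star x) b := fun b hb =>
    (VonNeumannAlgebra.mem_commutant_iff.1 (star_mem hx) b hb).symm
  have hre : ∀ b ∈ S, Commute (realPart x : H →L[ℂ] H) b := fun b hb => by
    rw [realPart_apply_coe]
    exact ((hc b hb).add_left (hc' b hb)).smul_left _
  have him : ∀ b ∈ S, Commute (imaginaryPart x : H →L[ℂ] H) b := fun b hb => by
    rw [imaginaryPart_apply_coe]
    exact (((hc b hb).sub_left (hc' b hb)).smul_left _).smul_left _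
  have hpos : ∀ a : H →L[ℂ] H, (∀ b ∈ S, Commute a b) → Commute a⁺ n := fun a ha =>
    hd_commute_nonneg S n hn _
      (fun b hb => by rw [CFC.posPart_def]; exact (ha b hb).cfcₙ_real _) (CFC.posPart_nonneg a)
  have hneg : ∀ a : H →L[ℂ] H, (∀ b ∈ S, Commute a b) → Commute a⁻ n := fun a ha =>
    hd_commute_nonneg S n hn _
      (fun b hb => by rw [CFC.negPart_def]; exact (ha b hb).cfcₙ_real _) (CFC.negPart_nonneg a)
  have hsa : ∀ a : H →L[ℂ] H, IsSelfAdjoint a → (∀ b ∈ S, Commute a b) → Commute a n := by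
    intro a hs ha
    rw [← CFC.posPart_sub_negPart a hs]
    exact (hpos a ha).sub_left (hneg a ha)
  rw [← realPart_add_I_smul_imaginaryPart x]
  exact (hsa _ (realPart x).2 hre).add_left ((hsa _ (imaginaryPart x).2 him).smul_left _)

end Helpers

/-- If the cyclic subspaces of `M_A.commutant` and `M_B` coincide for every vector,
then Haag duality holds. -/
theorem haagDuality_of_cyclic_subspaces_eq {H : Type*} [NormedAddCommGroup H]
    [InnerProductSpace ℂ H] [CompleteSpace H]
    (M_A M_B : VonNeumannAlgebra H)
    (hcomm : ∀ a ∈ M_A, ∀ b ∈ M_B, a * b = b * a)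
    (hcyc : ∀ Ψ : H,
      (Submodule.span ℂ {x : H | ∃ a ∈ M_A.commutant, a Ψ = x}).topologicalClosure =
      (Submodule.span ℂ {x : H | ∃ b ∈ M_B, b Ψ = x}).topologicalClosure) :
    M_B = M_A.commutant := by
  have hker : ∀ n ∈ M_A.commutant, ∀ y ∈ M_B.commutant, ∀ v, y v = 0 → y (n v) = 0 := by
    intro n hn y hy v hv
    have h1 : n v ∈ (Submodule.span ℂ {x : H | ∃ b ∈ M_B, b v = x}).topologicalClosure := by
      rw [← hcyc v]
      exact Submodule.le_topologicalClosure _ (Submodule.subset_span ⟨n, hn, rfl⟩)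
    have h2 : (Submodule.span ℂ {x : H | ∃ b ∈ M_B, b v = x}).topologicalClosure ≤
        LinearMap.ker y.toLinearMap := by
      refine Submodule.topologicalClosure_minimal _ (Submodule.span_le.2 ?_) y.isClosed_ker
      rintro _ ⟨b, hb, rfl⟩
      have := congrArg (fun T : H →L[ℂ] H => T v)
        (VonNeumannAlgebra.mem_commutant_iff.1 hy b hb)
      simp only [mul_apply_eq_comp, hv, map_zero] at this
      exact this.symm
    exact h2 h1
  apply VonNeumannAlgebra.ext
  intro n
  constructor
  · intro hn
    rw [VonNeumannAlgebra.mem_commutant_iff]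
    exact fun a ha => hcomm a ha n hn
  · intro hn
    rw [← VonNeumannAlgebra.commutant_commutant M_B, VonNeumannAlgebra.mem_commutant_iff]
    intro x hx
    exact hd_commute_all M_B n
      (fun y hy v hv => ⟨hker n hn y hy v hv, hker _ (star_mem hn) y hy v hv⟩) x hx
end
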